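/- arXiv:2512.13412 — 6 statements merged into one kernel-verified Lean document; each statement's English description precedes it below -/
import Mathlib

section
/- For an admissible multi-index (n₁,…,n_r) of positive integers (i.e. n_r ≥ 2), the family of real numbers 1/(k₁^{n₁} · k₂^{n₂} ⋯ k_r^{n_r}), indexed by the set of r-tuples of positive integers with k_r > k_{r−1} > ⋯ > k₁ ≥ 1, is summable; hence the multiple zeta value ζ(n₁,…,n_r) is a well-defined real number. -/
/-- A finite power of a nonnegative summable family is summable. -/
theorem summable_pi_prod_aux (f : ℕ+ → ℝ) (hf : Summable f) (h0 : ∀ k, 0 ≤ f k) (r : ℕ) :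
    Summable (fun k : Fin r → ℕ+ => ∏ i, f (k i)) := by
  induction r with
  | zero => exact (hasSum_fintype _).summable
  | succ r ih =>
    have h := hf.mul_of_nonneg ih h0 (fun k => Finset.prod_nonneg fun i _ => h0 _)
    rw [← (Fin.consEquiv (fun _ : Fin (r + 1) => ℕ+)).summable_iff]
    refine h.congr fun p => ?_
    simp [Fin.prod_univ_succ, Fin.consEquiv]

/-- For an admissible multi-index `(n 0, …, n (r-1))` of positive integers
(`n (r-1) ≥ 2`), the family `k ↦ ∏ i, 1 / (k i)^(n i)`, indexed by strictly increasing
`r`-tuples of positive integers, is summable. -/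
theorem mzv_summable (r : ℕ) (hr : 0 < r) (n : Fin r → ℕ)
    (hpos : ∀ i, 1 ≤ n i) (hadm : 2 ≤ n ⟨r - 1, Nat.sub_lt hr Nat.one_pos⟩) :
    Summable (fun k : {k : Fin r → ℕ+ // StrictMono k} =>
      ∏ i, (1 : ℝ) / ((k.1 i : ℕ) : ℝ) ^ (n i)) := by
  have hr' : (0 : ℝ) < r := by exact_mod_cast hr
  set l : Fin r := ⟨r - 1, Nat.sub_lt hr Nat.one_pos⟩ with hl
  let f : ℕ+ → ℝ := fun k => ((k : ℕ) : ℝ)⁻¹ * (((k : ℕ) : ℝ) ^ ((1 : ℝ) / r))⁻¹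
  have hf : Summable f := by
    have h1 : Summable (fun k : ℕ => 1 / (k : ℝ) ^ (1 + (1 : ℝ) / r)) :=
      Real.summable_one_div_nat_rpow.2 (by have := one_div_pos.2 hr'; linarith)
    have h2 := h1.comp_injective PNat.coe_injective
    refine h2.congr fun k => ?_
    have hk : (0 : ℝ) < ((k : ℕ) : ℝ) := by exact_mod_cast k.pos
    simp only [Function.comp, f]
    rw [Real.rpow_add hk, Real.rpow_one, one_div, mul_inv]
  have hS := (summable_pi_prod_aux f hf (fun k => by positivity) r).comp_injective
    (Subtype.val_injective (p := fun k : Fin r → ℕ+ => StrictMono k))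
  refine Summable.of_nonneg_of_le (fun k => by positivity) (fun k => ?_) hS
  obtain ⟨k, hk⟩ := k
  simp only [Function.comp, f]
  have h1 : ∀ i, (1 : ℝ) ≤ ((k i : ℕ) : ℝ) := fun i => by exact_mod_cast (k i).pos
  have h0 : ∀ i, (0 : ℝ) < ((k i : ℕ) : ℝ) := fun i => lt_of_lt_of_le one_pos (h1 i)
  calc ∏ i, (1 : ℝ) / ((k i : ℕ) : ℝ) ^ (n i)
      ≤ ∏ i, (((k i : ℕ) : ℝ)⁻¹ * if i = l then ((k i : ℕ) : ℝ)⁻¹ else 1) := by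
        refine Finset.prod_le_prod (fun i _ => by positivity) (fun i _ => ?_)
        split_ifs with h
        · subst h
          rw [one_div, ← mul_inv, ← pow_two]
          have := h0 l
          exact inv_anti₀ (by positivity) (pow_le_pow_right₀ (h1 _) hadm)
        · rw [mul_one, one_div]
          exact inv_anti₀ (h0 i) (le_self_pow₀ (h1 i) (by have := hpos i; omega))
    _ = (∏ i, ((k i : ℕ) : ℝ)⁻¹) * ((k l : ℕ) : ℝ)⁻¹ := by
        rw [Finset.prod_mul_distrib]; simp
    _ = (∏ i, ((k i : ℕ) : ℝ)⁻¹) * ∏ _i : Fin r, (((k l : ℕ) : ℝ) ^ ((1 : ℝ) / r))⁻¹ := by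
        congr 1
        rw [Finset.prod_const, Finset.card_univ, Fintype.card_fin, inv_pow, ← Real.rpow_natCast,
          ← Real.rpow_mul (h0 l).le, one_div_mul_cancel hr'.ne', Real.rpow_one]
    _ ≤ (∏ i, ((k i : ℕ) : ℝ)⁻¹) * ∏ i, (((k i : ℕ) : ℝ) ^ ((1 : ℝ) / r))⁻¹ := by
        refine mul_le_mul_of_nonneg_left ?_ (by positivity)
        refine Finset.prod_le_prod (fun i _ => by positivity) (fun i _ => ?_)
        have := h0 i
        refine inv_anti₀ (by positivity) (Real.rpow_le_rpow (h0 i).le ?_ (by positivity))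
        have hil : i ≤ l := by rw [Fin.le_def]; have := i.2; simp only [hl]; omega
        exact_mod_cast hk.monotone hil
    _ = _ := by rw [← Finset.prod_mul_distrib]
end

section
/- Let N ≥ 4 be an integer and let j be an integer with 2 ≤ j ≤ N−2. Then the double-shuffle relation holds: ζ(j, N−j) + ζ(N−j, j) + ζ(N) = Σ_{k=2}^{N−1} ( C(k−1, j−1) + C(k−1, N−j−1) ) · ζ(N−k, k), where C(m, l) denotes the binomial coefficient. -/
/-- The single zeta value `ζ(n) = ∑_{k ≥ 1} 1 / k^n`. -/
noncomputable def zetaValue (n : ℕ) : ℝ := ∑' k : ℕ+, (1 : ℝ) / ((k : ℕ) : ℝ) ^ n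

/-- The double zeta value `ζ(a,b) = ∑_{l > k ≥ 1} 1 / (k^a * l^b)`. -/
noncomputable def doubleZeta (a b : ℕ) : ℝ :=
  ∑' p : {p : ℕ+ × ℕ+ // p.1 < p.2},
    (1 : ℝ) / (((p.1.1 : ℕ) : ℝ) ^ a * ((p.1.2 : ℕ) : ℝ) ^ b)

/-- Half of the partial fraction expansion. -/
noncomputable def pfT (s : ℝ) (a m : ℕ) (y : ℝ) : ℝ :=
  ∑ i ∈ Finset.range m, (Nat.choose i a : ℝ) * (1 / (y ^ (m - i) * s ^ (i + 1)))

lemma pfT_succ (s : ℝ) (a m : ℕ) (y : ℝ) :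
    pfT s (a + 1) (m + 1) y = (pfT s a m y + pfT s (a + 1) m y) * s⁻¹ := by
  unfold pfT
  rw [Finset.sum_range_succ', ← Finset.sum_add_distrib, Finset.sum_mul]
  simp only [Nat.choose_zero_succ, Nat.cast_zero, zero_mul, add_zero]
  refine Finset.sum_congr rfl fun i _ => ?_
  rw [Nat.choose_succ_succ, Nat.add_sub_add_right, pow_succ s (i + 1)]
  push_cast
  simp only [one_div, mul_inv]
  ring

lemma pfT_zero (s : ℝ) (m : ℕ) (y : ℝ) :
    pfT s 0 (m + 1) y = (1 / y ^ (m + 1) + pfT s 0 m y) * s⁻¹ := by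
  unfold pfT
  rw [Finset.sum_range_succ', add_comm, add_mul, Finset.sum_mul]
  congr 1
  · simp [mul_comm]
  refine Finset.sum_congr rfl fun i _ => ?_
  rw [Nat.add_sub_add_right, pow_succ s (i + 1)]
  simp only [one_div, mul_inv, Nat.choose_zero_right]
  ring

lemma pfT_self (s : ℝ) (m : ℕ) (y : ℝ) : pfT s m m y = 0 := by
  unfold pfT
  refine Finset.sum_eq_zero fun i hi => ?_
  rw [Nat.choose_eq_zero_of_lt (Finset.mem_range.1 hi)]
  simp

lemma pf_step (x y : ℝ) (hx : 0 < x) (hy : 0 < y) (a b : ℕ) :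
    1 / (x ^ (a + 1) * y ^ (b + 1)) =
      (1 / (x ^ a * y ^ (b + 1)) + 1 / (x ^ (a + 1) * y ^ b)) * (x + y)⁻¹ := by
  have : x + y ≠ 0 := by positivity
  field_simp
  ring

lemma pf_base (x y : ℝ) (hx : 0 < x) (hy : 0 < y) (b : ℕ) :
    1 / (x ^ 1 * y ^ (b + 1)) = pfT (x + y) 0 (b + 1) y + pfT (x + y) b (b + 1) x := by
  induction b with
  | zero =>
    have : x + y ≠ 0 := by positivity
    simp [pfT]
    field_simp
  | succ b ih =>
    rw [pfT_zero, pfT_succ, pfT_self, pf_step x y hx hy 0 (b + 1), ih]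
    simp only [pow_zero, one_mul]
    ring

lemma pf (x y : ℝ) (hx : 0 < x) (hy : 0 < y) (a b : ℕ) :
    1 / (x ^ (a + 1) * y ^ (b + 1)) =
      pfT (x + y) a (a + b + 1) y + pfT (x + y) b (a + b + 1) x := by
  induction a generalizing b with
  | zero => simpa using pf_base x y hx hy b
  | succ a iha =>
    induction b with
    | zero =>
      have := pf_base y x hy hx (a + 1)
      rw [add_comm y x] at this
      rw [mul_comm, add_comm (pfT _ _ _ _)]
      simpa using this
    | succ b ihb =>
      rw [pf_step x y hx hy (a + 1) (b + 1), iha, ihb,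
        show a + 1 + (b + 1) + 1 = (a + b + 2) + 1 by ring,
        pfT_succ _ a (a + b + 2), pfT_succ _ b (a + b + 2),
        show a + (b + 1) + 1 = a + b + 2 by ring, show a + 1 + b + 1 = a + b + 2 by ring]
      ring

/-- The bijection `(m, n) ↦ (n, m + n)`. -/
def shEquiv : ℕ+ × ℕ+ ≃ {p : ℕ+ × ℕ+ // p.1 < p.2} where
  toFun p := ⟨(p.2, p.1 + p.2), PNat.lt_add_left _ _⟩
  invFun q := (q.1.2 - q.1.1, q.1.1)
  left_inv p := by
    ext
    · simp
    · rfl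
  right_inv q := by
    apply Subtype.ext
    apply Prod.ext
    · rfl
    · change q.1.2 - q.1.1 + q.1.1 = q.1.2
      rw [add_comm]
      exact PNat.add_sub_of_lt q.2

/-- shuffle term -/
noncomputable def shG (c k : ℕ) (p : ℕ+ × ℕ+) : ℝ :=
  1 / (((p.2 : ℕ) : ℝ) ^ c * (((p.1 : ℕ) : ℝ) + ((p.2 : ℕ) : ℝ)) ^ k)

lemma shG_nonneg (c k : ℕ) (p : ℕ+ × ℕ+) : 0 ≤ shG c k p := by
  unfold shG; positivity

lemma tsum_shG (c k : ℕ) : ∑' p, shG c k p = doubleZeta c k := by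
  unfold doubleZeta
  rw [← shEquiv.tsum_eq]
  refine tsum_congr fun p => ?_
  simp [shG, shEquiv]

lemma tsum_shG_swap (c k : ℕ) : ∑' p, shG c k (Prod.swap p) = doubleZeta c k := by
  rw [← tsum_shG]
  exact (Equiv.prodComm ℕ+ ℕ+).tsum_eq (shG c k)

/-- The product term. -/
noncomputable def prF (a b : ℕ) (p : ℕ+ × ℕ+) : ℝ :=
  1 / (((p.1 : ℕ) : ℝ) ^ a * ((p.2 : ℕ) : ℝ) ^ b)

lemma summable_pnat (a : ℕ) (ha : 2 ≤ a) : Summable fun k : ℕ+ => (1 : ℝ) / ((k : ℕ) : ℝ) ^ a :=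
  (Real.summable_one_div_nat_pow.2 ha).comp_injective PNat.coe_injective

lemma summable_prF (a b : ℕ) (ha : 2 ≤ a) (hb : 2 ≤ b) : Summable (prF a b) := by
  have := (summable_pnat a ha).mul_of_nonneg (summable_pnat b hb)
    (fun k => by positivity) (fun k => by positivity)
  refine this.congr fun p => ?_
  simp [prF, mul_comm]

lemma stuffle (a b : ℕ) (ha : 2 ≤ a) (hb : 2 ≤ b) :
    ∑' p, prF a b p = doubleZeta a b + doubleZeta b a + zetaValue (a + b) := by
  have hs := summable_prF a b ha hb
  have h1 : ∑' p, Set.indicator {p : ℕ+ × ℕ+ | p.1 < p.2} (prF a b) p = doubleZeta a b := by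
    rw [← tsum_subtype]; rfl
  have h2 : ∑' p, Set.indicator {p : ℕ+ × ℕ+ | p.2 < p.1} (prF a b) p = doubleZeta b a := by
    rw [← tsum_subtype]
    let e : {p : ℕ+ × ℕ+ // p.1 < p.2} ≃ {p : ℕ+ × ℕ+ | p.2 < p.1} :=
      (Equiv.prodComm ℕ+ ℕ+).subtypeEquiv (fun p => Iff.rfl)
    rw [← e.tsum_eq]
    refine tsum_congr fun p => ?_
    change prF a b (p.1.2, p.1.1) = _
    rw [prF, mul_comm]
  have h3 : ∑' p, Set.indicator {p : ℕ+ × ℕ+ | p.1 = p.2} (prF a b) p = zetaValue (a + b) := by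
    rw [← tsum_subtype]
    let e : ℕ+ ≃ {p : ℕ+ × ℕ+ | p.1 = p.2} :=
      { toFun := fun n => ⟨(n, n), rfl⟩
        invFun := fun p => p.1.1
        left_inv := fun n => rfl
        right_inv := fun p => Subtype.ext (Prod.ext rfl p.2) }
    rw [← e.tsum_eq]
    refine tsum_congr fun p => ?_
    change prF a b (p, p) = _
    rw [prF, pow_add]
  rw [← h1, ← h2, ← h3, ← (hs.indicator _).tsum_add (hs.indicator _),
    ← ((hs.indicator _).add (hs.indicator _)).tsum_add (hs.indicator _)]
  refine tsum_congr fun p => ?_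
  rcases lt_trichotomy p.1 p.2 with h | h | h
  · simp [Set.indicator, h, h.ne, h.le]
  · simp [Set.indicator, h]
  · simp [Set.indicator, h, h.ne', h.le]

lemma prF_eq (a b : ℕ) (p : ℕ+ × ℕ+) :
    prF (a + 1) (b + 1) p = ∑ i ∈ Finset.range (a + b + 1),
      ((Nat.choose i a : ℝ) * shG (a + b + 1 - i) (i + 1) p +
        (Nat.choose i b : ℝ) * shG (a + b + 1 - i) (i + 1) p.swap) := by
  have := pf ((p.1 : ℕ) : ℝ) ((p.2 : ℕ) : ℝ) (by positivity) (by positivity) a b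
  rw [prF, this, Finset.sum_add_distrib]
  simp [pfT, shG, add_comm ((p.2 : ℕ) : ℝ)]

lemma shuffle (a b : ℕ) (ha : 1 ≤ a) (hb : 1 ≤ b) :
    ∑' p, prF (a + 1) (b + 1) p = ∑ i ∈ Finset.range (a + b + 1),
      ((Nat.choose i a + Nat.choose i b : ℕ) : ℝ) * doubleZeta (a + b + 1 - i) (i + 1) := by
  have hs := summable_prF (a + 1) (b + 1) (by omega) (by omega)
  have n1 : ∀ i p, 0 ≤ (Nat.choose i a : ℝ) * shG (a + b + 1 - i) (i + 1) p :=
    fun i p => mul_nonneg (Nat.cast_nonneg _) (shG_nonneg _ _ _)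
  have n2 : ∀ i p, 0 ≤ (Nat.choose i b : ℝ) * shG (a + b + 1 - i) (i + 1) (Prod.swap p) :=
    fun i p => mul_nonneg (Nat.cast_nonneg _) (shG_nonneg _ _ _)
  have le : ∀ i ∈ Finset.range (a + b + 1), ∀ p,
      (Nat.choose i a : ℝ) * shG (a + b + 1 - i) (i + 1) p +
        (Nat.choose i b : ℝ) * shG (a + b + 1 - i) (i + 1) p.swap ≤ prF (a + 1) (b + 1) p := by
    intro i hi p
    rw [prF_eq]
    exact Finset.single_le_sum (f := fun i => (Nat.choose i a : ℝ) * shG (a + b + 1 - i) (i + 1) p +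
        (Nat.choose i b : ℝ) * shG (a + b + 1 - i) (i + 1) p.swap)
        (fun i _ => add_nonneg (n1 i p) (n2 i p)) hi
  have s1 : ∀ i ∈ Finset.range (a + b + 1), Summable fun p =>
      (Nat.choose i a : ℝ) * shG (a + b + 1 - i) (i + 1) p := fun i hi =>
    Summable.of_nonneg_of_le (n1 i) (fun p => by linarith [le i hi p, n2 i p]) hs
  have s2 : ∀ i ∈ Finset.range (a + b + 1), Summable fun p : ℕ+ × ℕ+ =>
      (Nat.choose i b : ℝ) * shG (a + b + 1 - i) (i + 1) p.swap := fun i hi =>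
    Summable.of_nonneg_of_le (n2 i) (fun p => by linarith [le i hi p, n1 i p]) hs
  rw [tsum_congr (prF_eq a b), Summable.tsum_finsetSum fun i hi => (s1 i hi).add (s2 i hi)]
  refine Finset.sum_congr rfl fun i hi => ?_
  rw [(s1 i hi).tsum_add (s2 i hi), tsum_mul_left, tsum_mul_left, tsum_shG, tsum_shG_swap]
  push_cast
  ring

/-- the double-shuffle relations. -/
theorem double_shuffle (N j : ℕ) (hN : 4 ≤ N) (hj : 2 ≤ j) (hjN : j ≤ N - 2) :
    doubleZeta j (N - j) + doubleZeta (N - j) j + zetaValue N =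
      ∑ k ∈ Finset.Icc 2 (N - 1),
        ((Nat.choose (k - 1) (j - 1) + Nat.choose (k - 1) (N - j - 1) : ℕ) : ℝ) *
          doubleZeta (N - k) k := by
  obtain ⟨a, rfl⟩ : ∃ a, j = a + 2 := ⟨j - 2, by omega⟩
  obtain ⟨b, rfl⟩ : ∃ b, N = a + 2 + (b + 2) := ⟨N - a - 4, by omega⟩
  have h1 := stuffle (a + 2) (b + 2) (by omega) (by omega)
  have h2 := shuffle (a + 1) (b + 1) (by omega) (by omega)
  rw [Nat.add_sub_cancel_left, ← h1, h2, Finset.sum_range_succ']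
  have : Finset.Icc 2 (a + 2 + (b + 2) - 1) = Finset.Ico 2 (a + 2 + (b + 2)) := by
    ext; simp; omega
  rw [this, Finset.sum_Ico_eq_sum_range]
  simp only [Nat.choose_zero_succ, add_zero, Nat.cast_zero, zero_mul]
  refine Finset.sum_congr (by congr 1; omega) fun i _ => ?_
  rw [show 2 + i - 1 = i + 1 by omega, show a + 2 - 1 = a + 1 by omega,
    show b + 2 - 1 = b + 1 by omega, show 2 + i = i + 1 + 1 by omega,
    show a + 1 + (b + 1) + 1 - (i + 1) = a + 2 + (b + 2) - (i + 1 + 1) by omega]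
end

section
/- Let (ε₁,…,ε_r) and (ε_{r+1},…,ε_{r+s}) be two admissible words in {0,1} (each begins with 1 and ends with 0). Then the product of the two convergent iterated integrals satisfies the shuffle product formula: I(0; ε₁⋯ε_r; 1) · I(0; ε_{r+1}⋯ε_{r+s}; 1) = Σ_{σ ∈ 𝔖(r,s)} I(0; η^σ; 1), where the sum runs over all (r,s)-shuffles σ (permutations of {1,…,r+s} with σ(1) < ⋯ < σ(r) and σ(r+1) < ⋯ < σ(r+s)) and η^σ is the word of length r+s whose letter in position σ(i) is ε_i; every word η^σ appearing in the sum is admissible. -/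
open MeasureTheory

/-- The iterated integral `I(0; ε₁ ⋯ ε_n; 1) = ∫_{0 < t₁ < ⋯ < t_n < 1} ∏ i, dt_i/(ε_i - t_i)`. -/
noncomputable def iteratedIntegral {n : ℕ} (ε : Fin n → ℝ) : ℝ :=
  ∫ t in {t : Fin n → ℝ | StrictMono t ∧ ∀ i, t i ∈ Set.Ioo (0 : ℝ) 1},
    ∏ i, 1 / (ε i - t i)


namespace ShuffleAux

/-- The open simplex. -/
def simplex (n : ℕ) : Set (Fin n → ℝ) :=
  {t : Fin n → ℝ | StrictMono t ∧ ∀ i, t i ∈ Set.Ioo (0 : ℝ) 1}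

theorem measurableSet_simplex (n : ℕ) : MeasurableSet (simplex n) := by
  have : simplex n = (⋂ (i : Fin n) (j : Fin n) (_ : i < j), {t : Fin n → ℝ | t i < t j}) ∩
      ⋂ i : Fin n, {t : Fin n → ℝ | t i ∈ Set.Ioo (0 : ℝ) 1} := by
    ext t
    simp only [simplex, StrictMono, Set.mem_ofPred_eq, Set.mem_inter_iff, Set.mem_iInter]
  rw [this]
  refine MeasurableSet.inter ?_ ?_
  · refine MeasurableSet.iInter fun i => MeasurableSet.iInter fun j => MeasurableSet.iInter fun _ => ?_
    exact measurableSet_lt (measurable_pi_apply i) (measurable_pi_apply j)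
  · refine MeasurableSet.iInter fun i => ?_
    exact (measurable_pi_apply i) measurableSet_Ioo

theorem prod_bound {n : ℕ} (u : Fin n → ℝ) (hu : ∀ i, 0 < u i) (j : Fin n)
    (hj : ∀ i, u j ≤ u i) :
    ∏ i ∈ Finset.univ.erase j, (u i)⁻¹ ≤ ∏ i, (u i) ^ ((1 : ℝ) / n - 1) := by
  have hn : 0 < n := j.pos
  have hn' : (0 : ℝ) < n := by exact_mod_cast hn
  rw [← Finset.mul_prod_erase Finset.univ _ (Finset.mem_univ j)]
  have h1 : ∏ i ∈ Finset.univ.erase j, (u i)⁻¹ ≤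
      ∏ i ∈ Finset.univ.erase j, ((u i) ^ ((1 : ℝ) / n - 1) * (u j) ^ (-((1 : ℝ) / n))) := by
    refine Finset.prod_le_prod (fun i _ => (inv_pos.2 (hu i)).le) fun i _ => ?_
    have h2 : (u i)⁻¹ = (u i) ^ ((1 : ℝ) / n - 1) * (u i) ^ (-((1 : ℝ) / n)) := by
      rw [← Real.rpow_add (hu i), ← Real.rpow_neg_one]
      congr 1
      ring
    rw [h2]
    refine mul_le_mul_of_nonneg_left ?_ (Real.rpow_nonneg (hu i).le _)
    refine Real.rpow_le_rpow_of_nonpos (hu j) (hj i) ?_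
    have : 0 < (1 : ℝ) / n := by positivity
    linarith
  refine h1.trans (le_of_eq ?_)
  rw [Finset.prod_mul_distrib, Finset.prod_const, Finset.card_erase_of_mem (Finset.mem_univ j),
    Finset.card_univ, Fintype.card_fin, mul_comm]
  congr 1
  rw [← Real.rpow_natCast, ← Real.rpow_mul (hu j).le]
  congr 1
  rw [Nat.cast_sub hn]
  field_simp
  push_cast
  ring

theorem integrableOn_beta (a : ℝ) (ha : 0 < a) :
    IntegrableOn (fun t : ℝ => t ^ (a - 1) * (1 - t) ^ (a - 1)) (Set.Ioo 0 1) := by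
  have h := Complex.betaIntegral_convergent (u := a) (v := a) (by simpa) (by simpa)
  rw [intervalIntegrable_iff_integrableOn_Ioo_of_le (by simp)] at h
  refine IntegrableOn.congr_fun h.norm ?_ measurableSet_Ioo
  intro x hx
  have h1 : (0 : ℝ) < 1 - x := by linarith [hx.2]
  have e1 : ((a : ℂ) - 1) = ((a - 1 : ℝ) : ℂ) := by push_cast; rfl
  have e2 : (1 - (x : ℂ)) = ((1 - x : ℝ) : ℂ) := by push_cast; rfl
  simp only
  rw [norm_mul, e1, e2, Complex.norm_cpow_eq_rpow_re_of_pos hx.1,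
    Complex.norm_cpow_eq_rpow_re_of_pos h1, Complex.ofReal_re]

theorem integrand_bound {n : ℕ} (hn : 0 < n) (ε : Fin n → ℝ) (h : ∀ i, ε i = 0 ∨ ε i = 1)
    (h1 : ε ⟨0, hn⟩ = 1) (h0 : ε ⟨n - 1, Nat.sub_lt hn Nat.one_pos⟩ = 0)
    (t : Fin n → ℝ) (ht : t ∈ simplex n) :
    ‖∏ i, 1 / (ε i - t i)‖ ≤
      ∏ i, ((t i) ^ ((1 : ℝ) / n - 1) * (1 - t i) ^ ((1 : ℝ) / n - 1)) := by
  obtain ⟨hm, hI⟩ := ht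
  have p0 : ∀ i, 0 < t i := fun i => (hI i).1
  have p1 : ∀ i, 0 < 1 - t i := fun i => by linarith [(hI i).2]
  have b0 := prod_bound t p0 ⟨0, hn⟩ (fun i => hm.monotone (by simp [Fin.le_def]))
  have b1 := prod_bound (fun i => 1 - t i) p1 ⟨n - 1, Nat.sub_lt hn Nat.one_pos⟩
    (fun i => by
      have : t i ≤ t ⟨n - 1, Nat.sub_lt hn Nat.one_pos⟩ :=
        hm.monotone (by rw [Fin.le_def]; simp only; omega)
      linarith)
  have key : ‖∏ i, 1 / (ε i - t i)‖ =
      (∏ i, if ε i = 0 then (t i)⁻¹ else 1) * ∏ i, if ε i = 1 then (1 - t i)⁻¹ else 1 := by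
    rw [norm_prod, ← Finset.prod_mul_distrib]
    refine Finset.prod_congr rfl fun i _ => ?_
    rcases h i with hi | hi
    · simp [hi, abs_of_pos (p0 i)]
    · simp [hi, abs_of_pos (p1 i)]
  rw [key, Finset.prod_mul_distrib]
  refine mul_le_mul (le_trans ?_ b0) (le_trans ?_ b1) ?_ ?_
  · rw [← Finset.mul_prod_erase Finset.univ _ (Finset.mem_univ (⟨0, hn⟩ : Fin n)), h1]
    rw [if_neg one_ne_zero, one_mul]
    refine Finset.prod_le_prod (fun i _ => ?_) fun i _ => ?_
    · split_ifs
      · exact (inv_pos.2 (p0 i)).le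
      · exact zero_le_one
    · split_ifs
      · exact le_rfl
      · exact (one_le_inv₀ (p0 i)).2 (hI i).2.le
  · rw [← Finset.mul_prod_erase Finset.univ _
      (Finset.mem_univ (⟨n - 1, Nat.sub_lt hn Nat.one_pos⟩ : Fin n)), h0]
    rw [if_neg zero_ne_one, one_mul]
    refine Finset.prod_le_prod (fun i _ => ?_) fun i _ => ?_
    · split_ifs
      · exact (inv_pos.2 (p1 i)).le
      · exact zero_le_one
    · split_ifs
      · exact le_rfl
      · exact (one_le_inv₀ (p1 i)).2 (by linarith [p0 i])
  · refine Finset.prod_nonneg fun i _ => ?_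
    split_ifs
    · exact (inv_pos.2 (p1 i)).le
    · exact zero_le_one
  · exact Finset.prod_nonneg fun i _ => Real.rpow_nonneg (p0 i).le _

theorem integrableOn_simplex {n : ℕ} (hn : 0 < n) (ε : Fin n → ℝ) (h : ∀ i, ε i = 0 ∨ ε i = 1)
    (h1 : ε ⟨0, hn⟩ = 1) (h0 : ε ⟨n - 1, Nat.sub_lt hn Nat.one_pos⟩ = 0) :
    IntegrableOn (fun t : Fin n → ℝ => ∏ i, 1 / (ε i - t i)) (simplex n) := by
  have hn' : (0 : ℝ) < 1 / n := by
    have : (0 : ℝ) < n := by exact_mod_cast hn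
    positivity
  have hg : IntegrableOn (fun t : Fin n → ℝ =>
      ∏ i, ((t i) ^ ((1 : ℝ) / n - 1) * (1 - t i) ^ ((1 : ℝ) / n - 1)))
      (Set.univ.pi fun _ => Set.Ioo 0 1) := by
    rw [IntegrableOn, volume_pi, Measure.restrict_pi_pi]
    exact Integrable.fintype_prod (f := fun _ x => x ^ ((1 : ℝ) / n - 1) * (1 - x) ^ ((1 : ℝ) / n - 1))
      fun i => integrableOn_beta _ hn'
  have hg' := hg.mono_set (s := simplex n) (fun t ht i _ => ht.2 i)
  refine Integrable.mono' hg' ?_ ?_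
  · refine Measurable.aestronglyMeasurable ?_
    fun_prop
  · exact ae_restrict_of_forall_mem (measurableSet_simplex n)
      fun t ht => integrand_bound hn ε h h1 h0 t ht

theorem null_eq {n : ℕ} (i j : Fin n) (hij : i ≠ j) :
    volume {x : Fin n → ℝ | x i = x j} = 0 := by
  let L : (Fin n → ℝ) →ₗ[ℝ] ℝ := (LinearMap.proj i : (Fin n → ℝ) →ₗ[ℝ] ℝ) - LinearMap.proj j
  have e : {x : Fin n → ℝ | x i = x j} = (LinearMap.ker L : Set (Fin n → ℝ)) := by
    ext x
    simp [L, sub_eq_zero]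
  rw [e]
  refine Measure.addHaar_submodule _ _ fun htop => ?_
  have : Pi.single i (1 : ℝ) ∈ LinearMap.ker L := htop ▸ Submodule.mem_top
  simp [L, hij.symm] at this

theorem ae_injective (n : ℕ) : ∀ᵐ x : Fin n → ℝ, Function.Injective x := by
  have : ∀ᵐ x : Fin n → ℝ, ∀ i j : Fin n, i ≠ j → x i ≠ x j := by
    rw [ae_all_iff]; intro i
    rw [ae_all_iff]; intro j
    by_cases hij : i = j
    · simp [hij]
    · rw [ae_iff]
      simpa [hij] using null_eq i j hij
  filter_upwards [this] with x hx i j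
  exact not_imp_not.1 (hx i j)

/-- Concatenation as a measurable equivalence. -/
noncomputable def appendEquiv (r s : ℕ) : ((Fin r → ℝ) × (Fin s → ℝ)) ≃ᵐ (Fin (r + s) → ℝ) :=
  (MeasurableEquiv.sumPiEquivProdPi (fun _ : Fin r ⊕ Fin s => ℝ)).symm.trans
    (MeasurableEquiv.arrowCongr' finSumFinEquiv (MeasurableEquiv.refl ℝ))

theorem appendEquiv_mp (r s : ℕ) : MeasurePreserving (appendEquiv r s) :=
  (volume_preserving_arrowCongr' finSumFinEquiv (MeasurableEquiv.refl ℝ)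
    (MeasurePreserving.id _)).comp
    (volume_measurePreserving_sumPiEquivProdPi_symm (fun _ : Fin r ⊕ Fin s => ℝ))

theorem appendEquiv_castAdd (r s : ℕ) (p : (Fin r → ℝ) × (Fin s → ℝ)) (i : Fin r) :
    appendEquiv r s p (Fin.castAdd s i) = p.1 i := by
  change (Equiv.sumPiEquivProdPi (fun _ : Fin r ⊕ Fin s => ℝ)).symm p
    (finSumFinEquiv.symm (Fin.castAdd s i)) = _
  simp

theorem appendEquiv_natAdd (r s : ℕ) (p : (Fin r → ℝ) × (Fin s → ℝ)) (i : Fin s) :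
    appendEquiv r s p (Fin.natAdd r i) = p.2 i := by
  change (Equiv.sumPiEquivProdPi (fun _ : Fin r ⊕ Fin s => ℝ)).symm p
    (finSumFinEquiv.symm (Fin.natAdd r i)) = _
  simp

/-- The domain of the product integral. -/
def dom (r s : ℕ) : Set (Fin (r + s) → ℝ) :=
  {x | (fun i => x (Fin.castAdd s i)) ∈ simplex r ∧ (fun i => x (Fin.natAdd r i)) ∈ simplex s}

/-- The piece of the domain attached to a permutation. -/
def piece {n : ℕ} (σ : Equiv.Perm (Fin n)) : Set (Fin n → ℝ) :=
  {x | x ∘ σ.symm ∈ simplex n}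

theorem appendEquiv_preimage (r s : ℕ) :
    appendEquiv r s ⁻¹' dom r s = simplex r ×ˢ simplex s := by
  ext p
  simp [dom, appendEquiv_castAdd, appendEquiv_natAdd]

theorem prod_appendEquiv (r s : ℕ) (ε₁ : Fin r → ℝ) (ε₂ : Fin s → ℝ)
    (p : (Fin r → ℝ) × (Fin s → ℝ)) :
    ∏ i, 1 / (Fin.append ε₁ ε₂ i - appendEquiv r s p i) =
      (∏ i, 1 / (ε₁ i - p.1 i)) * ∏ i, 1 / (ε₂ i - p.2 i) := by
  rw [Fin.prod_univ_add]
  simp only [Fin.append_left, Fin.append_right, appendEquiv_castAdd, appendEquiv_natAdd]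

theorem product_eq (r s : ℕ) (ε₁ : Fin r → ℝ) (ε₂ : Fin s → ℝ) :
    iteratedIntegral ε₁ * iteratedIntegral ε₂ =
      ∫ x in dom r s, ∏ i, 1 / (Fin.append ε₁ ε₂ i - x i) := by
  rw [← (appendEquiv_mp r s).setIntegral_preimage_emb (appendEquiv r s).measurableEmbedding,
    appendEquiv_preimage]
  simp only [prod_appendEquiv]
  exact (setIntegral_prod_mul (μ := volume) (ν := volume) (fun t : Fin r → ℝ => ∏ i, 1 / (ε₁ i - t i))
    (fun t : Fin s → ℝ => ∏ i, 1 / (ε₂ i - t i)) (simplex r) (simplex s)).symm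

theorem integrableOn_dom (r s : ℕ) (ε₁ : Fin r → ℝ) (ε₂ : Fin s → ℝ)
    (H₁ : IntegrableOn (fun t : Fin r → ℝ => ∏ i, 1 / (ε₁ i - t i)) (simplex r))
    (H₂ : IntegrableOn (fun t : Fin s → ℝ => ∏ i, 1 / (ε₂ i - t i)) (simplex s)) :
    IntegrableOn (fun x => ∏ i, 1 / (Fin.append ε₁ ε₂ i - x i)) (dom r s) := by
  rw [← (appendEquiv_mp r s).integrableOn_comp_preimage (appendEquiv r s).measurableEmbedding,
    appendEquiv_preimage]
  have := Integrable.mul_prod H₁ H₂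
  rw [Measure.prod_restrict] at this
  refine this.congr (Filter.Eventually.of_forall fun p => ?_)
  exact (prod_appendEquiv r s ε₁ ε₂ p).symm

theorem measurableSet_piece {n : ℕ} (σ : Equiv.Perm (Fin n)) : MeasurableSet (piece σ) := by
  have : Measurable (fun x : Fin n → ℝ => x ∘ σ.symm) :=
    measurable_pi_lambda _ fun i => measurable_pi_apply _
  exact this (measurableSet_simplex n)

theorem integral_piece {n : ℕ} (ε : Fin n → ℝ) (σ : Equiv.Perm (Fin n)) :
    iteratedIntegral (ε ∘ ⇑σ.symm) = ∫ x in piece σ, ∏ i, 1 / (ε i - x i) := by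
  have hmp := volume_preserving_arrowCongr' σ (MeasurableEquiv.refl ℝ) (MeasurePreserving.id _)
  have := hmp.setIntegral_preimage_emb (MeasurableEquiv.measurableEmbedding _)
    (fun t : Fin n → ℝ => ∏ i, 1 / ((ε ∘ σ.symm) i - t i)) (simplex n)
  refine this.symm.trans ?_
  have e : ∀ x : Fin n → ℝ, MeasurableEquiv.arrowCongr' σ (MeasurableEquiv.refl ℝ) x = x ∘ σ.symm :=
    fun x => rfl
  have e2 : (MeasurableEquiv.arrowCongr' σ (MeasurableEquiv.refl ℝ)) ⁻¹' simplex n = piece σ := rfl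
  rw [e2]
  congr 1
  funext x
  rw [e]
  exact Equiv.prod_comp σ.symm (fun i => 1 / (ε i - x i))

theorem piece_subset {r s : ℕ} (σ : Equiv.Perm (Fin (r + s)))
    (h1 : StrictMono (fun i : Fin r => σ (Fin.castAdd s i)))
    (h2 : StrictMono (fun j : Fin s => σ (Fin.natAdd r j))) : piece σ ⊆ dom r s := by
  rintro x ⟨hm, hI⟩
  have hI' : ∀ i, x i ∈ Set.Ioo (0 : ℝ) 1 := fun i => by simpa using hI (σ i)
  refine ⟨⟨?_, fun i => hI' _⟩, ⟨?_, fun i => hI' _⟩⟩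
  · simpa [Function.comp_def] using hm.comp h1
  · simpa [Function.comp_def] using hm.comp h2

theorem exists_piece {r s : ℕ} (x : Fin (r + s) → ℝ) (hx : Function.Injective x)
    (hd : x ∈ dom r s) : ∃ σ : Equiv.Perm (Fin (r + s)),
      (StrictMono (fun i : Fin r => σ (Fin.castAdd s i)) ∧
        StrictMono (fun j : Fin s => σ (Fin.natAdd r j))) ∧ x ∈ piece σ := by
  obtain ⟨⟨m1, I1⟩, ⟨m2, I2⟩⟩ := hd
  have hs : StrictMono (x ∘ Tuple.sort x) :=
    (Tuple.monotone_sort x).strictMono_of_injective (hx.comp (Tuple.sort x).injective)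
  refine ⟨(Tuple.sort x).symm, ⟨?_, ?_⟩, ?_, ?_⟩
  · intro i j hij
    rw [← hs.lt_iff_lt]
    simpa using m1 hij
  · intro i j hij
    rw [← hs.lt_iff_lt]
    simpa using m2 hij
  · simpa using hs
  · have hI : ∀ i, x i ∈ Set.Ioo (0 : ℝ) 1 := fun i => by
      induction i using Fin.addCases with
      | left i => exact I1 i
      | right i => exact I2 i
    exact fun i => hI _

theorem piece_disjoint {n : ℕ} (σ τ : Equiv.Perm (Fin n)) (h : σ ≠ τ) :
    Disjoint (piece σ) (piece τ) := by
  rw [Set.disjoint_left]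
  rintro x ⟨h1, _⟩ ⟨h2, _⟩
  apply h
  have e := Tuple.unique_monotone h1.monotone h2.monotone
  have hx : Function.Injective x := by
    have := h1.injective.comp σ.injective
    simpa [Function.comp_assoc] using this
  have : σ.symm = τ.symm := Equiv.ext fun i => hx (congrFun e i)
  simpa using congrArg Equiv.symm this

theorem admissible (r s : ℕ) (hr : 0 < r) (hs : 0 < s)
    (ε₁ : Fin r → ℝ) (ε₂ : Fin s → ℝ)
    (h₁1 : ε₁ ⟨0, hr⟩ = 1) (h₁0 : ε₁ ⟨r - 1, Nat.sub_lt hr Nat.one_pos⟩ = 0)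
    (h₂1 : ε₂ ⟨0, hs⟩ = 1) (h₂0 : ε₂ ⟨s - 1, Nat.sub_lt hs Nat.one_pos⟩ = 0)
    (ha : 0 < r + s) (hb : r + s - 1 < r + s)
    (σ : Equiv.Perm (Fin (r + s)))
    (m1 : StrictMono (fun i : Fin r => σ (Fin.castAdd s i)))
    (m2 : StrictMono (fun j : Fin s => σ (Fin.natAdd r j))) :
    (Fin.append ε₁ ε₂ ∘ ⇑σ.symm) ⟨0, ha⟩ = 1 ∧
        (Fin.append ε₁ ε₂ ∘ ⇑σ.symm) ⟨r + s - 1, hb⟩ = 0 := by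
  constructor
  · obtain ⟨k, hk⟩ := σ.surjective ⟨0, ha⟩
    rw [← hk, Function.comp_apply, Equiv.symm_apply_apply]
    induction k using Fin.addCases with
    | left i =>
      have : i = ⟨0, hr⟩ := by
        by_contra hne
        have hlt : (⟨0, hr⟩ : Fin r) < i := by
          rw [Fin.lt_def]; exact Nat.pos_of_ne_zero fun h => hne (Fin.ext h)
        have := m1 hlt
        simp only [hk, Fin.lt_def] at this
        omega
      rw [Fin.append_left, this, h₁1]
    | right i =>
      have : i = ⟨0, hs⟩ := by
        by_contra hne
        have hlt : (⟨0, hs⟩ : Fin s) < i := by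
          rw [Fin.lt_def]; exact Nat.pos_of_ne_zero fun h => hne (Fin.ext h)
        have := m2 hlt
        simp only [hk, Fin.lt_def] at this
        omega
      rw [Fin.append_right, this, h₂1]
  · obtain ⟨k, hk⟩ := σ.surjective ⟨r + s - 1, hb⟩
    rw [← hk, Function.comp_apply, Equiv.symm_apply_apply]
    induction k using Fin.addCases with
    | left i =>
      have : i = ⟨r - 1, Nat.sub_lt hr Nat.one_pos⟩ := by
        by_contra hne
        have hlt : i < (⟨r - 1, Nat.sub_lt hr Nat.one_pos⟩ : Fin r) := by
          have h3 : (i : ℕ) ≠ r - 1 := fun h => hne (Fin.ext h)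
          rw [Fin.lt_def]
          simp only
          omega
        have := m1 hlt
        simp only [hk, Fin.lt_def] at this
        omega
      rw [Fin.append_left, this, h₁0]
    | right i =>
      have : i = ⟨s - 1, Nat.sub_lt hs Nat.one_pos⟩ := by
        by_contra hne
        have hlt : i < (⟨s - 1, Nat.sub_lt hs Nat.one_pos⟩ : Fin s) := by
          have h3 : (i : ℕ) ≠ s - 1 := fun h => hne (Fin.ext h)
          rw [Fin.lt_def]
          simp only
          omega
        have := m2 hlt
        simp only [hk, Fin.lt_def] at this
        omega
      rw [Fin.append_right, this, h₂0]

end ShuffleAux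

-- STATEMENT 3: the shuffle product formula for iterated integrals attached to two
-- admissible words, together with the admissibility of every word appearing in the sum.
open Classical in
theorem shuffle_product_iterated_integrals (r s : ℕ) (hr : 0 < r) (hs : 0 < s)
    (ε₁ : Fin r → ℝ) (ε₂ : Fin s → ℝ)
    (h₁ : ∀ i, ε₁ i = 0 ∨ ε₁ i = 1) (h₂ : ∀ i, ε₂ i = 0 ∨ ε₂ i = 1)
    (h₁1 : ε₁ ⟨0, hr⟩ = 1) (h₁0 : ε₁ ⟨r - 1, Nat.sub_lt hr Nat.one_pos⟩ = 0)
    (h₂1 : ε₂ ⟨0, hs⟩ = 1) (h₂0 : ε₂ ⟨s - 1, Nat.sub_lt hs Nat.one_pos⟩ = 0) :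
    (∀ σ : Equiv.Perm (Fin (r + s)),
        StrictMono (fun i : Fin r => σ (Fin.castAdd s i)) →
        StrictMono (fun j : Fin s => σ (Fin.natAdd r j)) →
        (Fin.append ε₁ ε₂ ∘ ⇑σ.symm) ⟨0, by omega⟩ = 1 ∧
        (Fin.append ε₁ ε₂ ∘ ⇑σ.symm) ⟨r + s - 1, by omega⟩ = 0) ∧
    iteratedIntegral ε₁ * iteratedIntegral ε₂ =
      ∑ σ ∈ Finset.univ.filter (fun σ : Equiv.Perm (Fin (r + s)) =>
          StrictMono (fun i : Fin r => σ (Fin.castAdd s i)) ∧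
          StrictMono (fun j : Fin s => σ (Fin.natAdd r j))),
        iteratedIntegral (Fin.append ε₁ ε₂ ∘ ⇑σ.symm) := by
  refine ⟨ShuffleAux.admissible r s hr hs ε₁ ε₂ h₁1 h₁0 h₂1 h₂0 _ _, ?_⟩
  have hint := ShuffleAux.integrableOn_dom r s ε₁ ε₂
    (ShuffleAux.integrableOn_simplex hr ε₁ h₁ h₁1 h₁0)
    (ShuffleAux.integrableOn_simplex hs ε₂ h₂ h₂1 h₂0)
  rw [ShuffleAux.product_eq]
  simp only [ShuffleAux.integral_piece]
  rw [← integral_biUnion_finset _ (fun σ _ => ShuffleAux.measurableSet_piece σ)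
    (fun σ _ τ _ h => ShuffleAux.piece_disjoint σ τ h)]
  · refine setIntegral_congr_set (Filter.eventuallyEq_set.2 ?_)
    filter_upwards [ShuffleAux.ae_injective (r + s)] with x hx
    simp only [Set.mem_iUnion, Finset.mem_filter, Finset.mem_univ, true_and, exists_prop]
    constructor
    · exact ShuffleAux.exists_piece x hx
    · rintro ⟨σ, ⟨m1, m2⟩, hσ⟩
      exact ShuffleAux.piece_subset σ m1 m2 hσ
  · intro σ hσ
    rw [Finset.mem_filter] at hσ
    exact hint.mono_set (ShuffleAux.piece_subset σ hσ.2.1 hσ.2.2)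
end

section
/- Let (ε₁,…,ε_n) ∈ {0,1}^n be an admissible word (ε₁ = 1 and ε_n = 0). Then the word ((1−ε_n), (1−ε_{n−1}), …, (1−ε₁)) is also admissible and the duality relation I(0; ε₁⋯ε_n; 1) = (−1)^n · I(0; (1−ε_n)(1−ε_{n−1})⋯(1−ε₁); 1) holds between the two convergent iterated integrals. -/
open MeasureTheory

/-- duality. For an admissible word `ε`, the reversed complemented word
`j ↦ 1 - ε (rev j)` is admissible and
`I(0; ε; 1) = (-1)^n · I(0; (1-ε_n) ⋯ (1-ε₁); 1)`. -/
theorem iterated_integral_duality (n : ℕ) (hn : 0 < n) (ε : Fin n → ℝ)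
    (hval : ∀ i, ε i = 0 ∨ ε i = 1)
    (h1 : ε ⟨0, hn⟩ = 1) (h0 : ε ⟨n - 1, Nat.sub_lt hn Nat.one_pos⟩ = 0) :
    ((fun j : Fin n => 1 - ε j.rev) ⟨0, hn⟩ = 1 ∧
      (fun j : Fin n => 1 - ε j.rev) ⟨n - 1, Nat.sub_lt hn Nat.one_pos⟩ = 0) ∧
    iteratedIntegral ε =
      (-1 : ℝ) ^ n * iteratedIntegral (fun j : Fin n => 1 - ε j.rev) := by
  have hr0 : (⟨0, hn⟩ : Fin n).rev = ⟨n - 1, Nat.sub_lt hn Nat.one_pos⟩ := by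
    ext; simp [Fin.rev]
  have hr1 : (⟨n - 1, Nat.sub_lt hn Nat.one_pos⟩ : Fin n).rev = ⟨0, hn⟩ := by
    rw [← hr0, Fin.rev_rev]
  refine ⟨⟨?_, ?_⟩, ?_⟩
  · simp only [hr0, h0, sub_zero]
  · simp only [hr1, h1, sub_self]
  let e1 : (Fin n → ℝ) ≃ᵐ (Fin n → ℝ) :=
    MeasurableEquiv.piCongrLeft (fun _ : Fin n => ℝ) Fin.revPerm
  let e2 : (Fin n → ℝ) ≃ᵐ (Fin n → ℝ) := MeasurableEquiv.subLeft (1 : Fin n → ℝ)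
  have m1 : MeasurePreserving e1 volume volume :=
    volume_measurePreserving_piCongrLeft (fun _ : Fin n => ℝ) Fin.revPerm
  have m2 : MeasurePreserving e2 volume volume :=
    Measure.measurePreserving_sub_left volume (1 : Fin n → ℝ)
  have m : MeasurePreserving (e1.trans e2) volume volume := m2.comp m1
  have happ : ∀ (t : Fin n → ℝ) (i : Fin n), (e1.trans e2) t i = 1 - t i.rev := by
    intro t i
    have h : e1 t i = t i.rev := by
      have := Equiv.piCongrLeft_apply_apply (fun _ : Fin n => ℝ) Fin.revPerm t i.rev
      simpa [e1, MeasurableEquiv.coe_piCongrLeft] using this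
    change 1 - e1 t i = _
    rw [h]
  have key := m.setIntegral_preimage_emb (e1.trans e2).measurableEmbedding
    (fun t : Fin n → ℝ => ∏ i, 1 / (ε i - t i))
    {t : Fin n → ℝ | StrictMono t ∧ ∀ i, t i ∈ Set.Ioo (0 : ℝ) 1}
  have hpre : (e1.trans e2) ⁻¹' {t : Fin n → ℝ | StrictMono t ∧ ∀ i, t i ∈ Set.Ioo (0 : ℝ) 1}
      = {t : Fin n → ℝ | StrictMono t ∧ ∀ i, t i ∈ Set.Ioo (0 : ℝ) 1} := by
    ext t
    simp only [Set.mem_preimage, Set.mem_setOf_eq, happ, Set.mem_Ioo]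
    constructor
    · rintro ⟨hm, hb⟩
      refine ⟨fun a b hab => ?_, fun i => ?_⟩
      · have := hm (Fin.rev_lt_rev.mpr hab)
        simp only [happ, Fin.rev_rev] at this
        linarith
      · have := hb i.rev
        rw [Fin.rev_rev] at this
        constructor <;> linarith
    · rintro ⟨hm, hb⟩
      refine ⟨fun a b hab => ?_, fun i => ?_⟩
      · have := hm (Fin.rev_lt_rev.mpr hab)
        simp only [happ]
        linarith
      · have := hb i.rev
        constructor <;> linarith
  rw [hpre] at key
  unfold iteratedIntegral
  rw [← key, ← integral_const_mul]
  congr 1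
  funext t
  simp only [happ]
  rw [← Equiv.prod_comp Fin.revPerm]
  have hc : (-1 : ℝ) ^ n = ∏ _i : Fin n, (-1 : ℝ) := by simp
  rw [hc, ← Finset.prod_mul_distrib]
  refine Finset.prod_congr rfl fun i _ => ?_
  simp only [Fin.revPerm_apply, Fin.rev_rev]
  rw [show ε i.rev - (1 - t i) = -(1 - ε i.rev - t i) by ring, one_div_neg_eq_neg_one_div]
  ring
end

section
/- Let a ≥ 2 be an even integer and b ≥ 3 an odd integer, and set N = a + b. Then ζ(a,b) = Σ_{r=3, r odd}^{N−2} ( C(r−1, b−1) + C(r−1, a−1) ) · ζ(r) · ζ(N−r) − (1/2)·( C(N, a) + 1 )·ζ(N), where the sum is over odd integers r with 3 ≤ r ≤ N−2 and C(m, l) denotes the binomial coefficient. -/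
theorem pf_s7 (X Y T : ℝ) (h : X * Y = T * (X + Y)) (M : ℕ) : ∀ α β : ℕ, α + β = M →
    X ^ (α+1) * Y ^ (β+1) = ∑ i ∈ Finset.range (M+1), T ^ (M+1-i) *
      ((Nat.choose (M-i) β : ℝ) * X ^ (i+1) + (Nat.choose (M-i) α : ℝ) * Y ^ (i+1)) := by
  induction M with
  | zero =>
    intro α β hab
    obtain ⟨rfl, rfl⟩ : α = 0 ∧ β = 0 := by omega
    simp [h]
  | succ M ih =>
    intro α β hab
    rcases α with _ | α
    · obtain rfl : β = M + 1 := by omega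
      have h1 := ih 0 M (by omega)
      have : X ^ (0+1) * Y ^ (M+1+1) = T * (X ^ (0+1) * Y ^ (M+1)) + T * Y ^ (M+2) := by
        linear_combination Y ^ (M+1) * h
      rw [this, h1, Finset.sum_range_succ _ (M+1), Finset.mul_sum]
      congr 1
      · apply Finset.sum_congr rfl
        intro i hi
        rw [Finset.mem_range] at hi
        have e1 : M + 1 + 1 - i = (M + 1 - i) + 1 := by omega
        rw [e1, pow_succ]
        have : (M + 1 - i).choose (M+1) = (M - i).choose M := by
          rcases i with _ | i
          · simp
          · rw [Nat.choose_eq_zero_of_lt (by omega), Nat.choose_eq_zero_of_lt (by omega)]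
        rw [this]; simp; ring
      · simp
    rcases β with _ | β
    · obtain rfl : α = M := by omega
      have h1 := ih α 0 (by omega)
      have : X ^ (α+1+1) * Y ^ (0+1) = T * (X ^ (α+1) * Y ^ (0+1)) + T * X ^ (α+2) := by
        linear_combination X ^ (α+1) * h
      rw [this, h1, Finset.sum_range_succ _ (α+1), Finset.mul_sum]
      congr 1
      · apply Finset.sum_congr rfl
        intro i hi
        rw [Finset.mem_range] at hi
        have e1 : α + 1 + 1 - i = (α + 1 - i) + 1 := by omega
        rw [e1, pow_succ]
        have : (α + 1 - i).choose (α+1) = (α - i).choose α := by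
          rcases i with _ | i
          · simp
          · rw [Nat.choose_eq_zero_of_lt (by omega), Nat.choose_eq_zero_of_lt (by omega)]
        rw [this]; simp; ring
      · simp
    · have h1 := ih α (β+1) (by omega)
      have h2 := ih (α+1) β (by omega)
      have : X ^ (α+1+1) * Y ^ (β+1+1) = T * (X ^ (α+1) * Y ^ (β+1+1)) + T * (X ^ (α+1+1) * Y ^ (β+1)) := by
        linear_combination X ^ (α+1) * Y ^ (β+1) * h
      rw [this, h1, h2, Finset.sum_range_succ _ (M+1), Finset.mul_sum, Finset.mul_sum, ← Finset.sum_add_distrib]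
      simp only [Nat.sub_self, Nat.choose_zero_succ, Nat.cast_zero, zero_mul, add_zero, mul_zero]
      apply Finset.sum_congr rfl
      intro i hi
      rw [Finset.mem_range] at hi
      have e1 : M + 1 + 1 - i = (M + 1 - i) + 1 := by omega
      have e2 : M + 1 - i = (M - i) + 1 := by omega
      rw [e1, pow_succ, e2, Nat.choose_succ_succ, Nat.choose_succ_succ]
      push_cast
      ring

theorem hockey (M α : ℕ) : ∑ i ∈ Finset.range (M+1), Nat.choose (M-i) α = Nat.choose (M+1) (α+1) := by
  have := Finset.sum_range_reflect (fun j => Nat.choose j α) (M+1)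
  simp only [Nat.add_sub_cancel] at this
  rw [this]
  induction M with
  | zero => rcases α with _ | α <;> simp [Nat.choose_eq_zero_of_lt]
  | succ M ih =>
    rw [Finset.sum_range_succ, ih, Nat.choose_succ_succ (M+1) α, add_comm]
    have := Finset.sum_range_reflect (fun j => Nat.choose j α) (M+1)
    simpa using this

theorem hasSum_of_eq {ι : Type*} {f g : ι → ℝ} {x y : ℝ} (h : HasSum f x)
    (h1 : ∀ i, g i = f i) (h2 : y = x) : HasSum g y := by
  obtain rfl : g = f := funext h1
  rw [h2]; exact h

theorem pnat_tsum (f : ℕ → ℝ) (h0 : f 0 = 0) : ∑' q : ℕ+, f q = ∑' n, f n := by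
  apply Function.Injective.tsum_eq (g := fun q : ℕ+ => (q : ℕ)) PNat.coe_injective
  intro n hn
  rcases Nat.eq_zero_or_pos n with rfl | h
  · exact absurd h0 hn
  · exact ⟨⟨n, h⟩, rfl⟩

theorem intsum (f : ℤ → ℝ) (hf : Summable f) (h0 : f 0 = 0) :
    ∑' m, f m = ∑' q : ℕ+, (f ((q : ℕ) : ℤ) + f (-((q : ℕ) : ℤ))) := by
  have h1 : Summable (fun n : ℕ => f n) := hf.comp_injective Nat.cast_injective
  have h2 : Summable (fun n : ℕ => f (-n)) :=
    hf.comp_injective (i := fun n : ℕ => -(n : ℤ)) (fun a b h => by simpa using h)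
  have := Summable.tsum_of_nat_of_neg h1 h2
  rw [this, h0, sub_zero, ← h1.tsum_add h2, ← pnat_tsum]
  simp [h0]

noncomputable def EE (k : ℕ) : ℝ := if Even k then 2 * zetaValue k else 0

theorem summable_int (k : ℕ) (hk : 2 ≤ k) : Summable (fun m : ℤ => ((m : ℝ)⁻¹) ^ k) := by
  have := (Real.summable_one_div_int_pow (p := k)).2 (by omega)
  simpa using this

theorem hasSum_int (k : ℕ) (hk : 2 ≤ k) : HasSum (fun m : ℤ => ((m : ℝ)⁻¹) ^ k) (EE k) := by
  have hs := summable_int k hk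
  have := intsum _ hs (by simp; omega)
  rw [hs.hasSum_iff, this]
  unfold EE zetaValue
  split_ifs with h
  · rw [← tsum_mul_left]
    congr 1; ext q
    push_cast
    rw [inv_neg, h.neg_pow]
    simp; ring
  · rw [Nat.not_even_iff_odd] at h
    simp [inv_neg, h.neg_pow]

theorem tele_nat : HasSum (fun n : ℕ => ((n : ℝ)+1)⁻¹ - ((n : ℝ)+2)⁻¹) 1 := by
  rw [hasSum_iff_tendsto_nat_of_nonneg]
  · have : ∀ n : ℕ, ∑ i ∈ Finset.range n, (((i : ℝ)+1)⁻¹ - ((i : ℝ)+2)⁻¹) = 1 - 1 / ((n : ℝ)+1) := by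
      intro n
      induction n with
      | zero => simp
      | succ n ih => rw [Finset.sum_range_succ, ih]; push_cast; ring
    simp_rw [this]
    simpa using (tendsto_one_div_add_atTop_nhds_zero_nat (𝕜 := ℝ)).const_sub 1
  · intro i
    rw [sub_nonneg]
    gcongr
    norm_num

theorem tele_int : HasSum (fun m : ℤ => (m : ℝ)⁻¹ - ((m : ℝ) - 1)⁻¹) 0 := by
  have : (0 : ℝ) = 1 + -1 := by norm_num
  rw [this]
  apply HasSum.of_nat_of_neg_add_one
  · rw [← hasSum_nat_add_iff' 2]
    convert tele_nat.neg using 1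
    · ext n; push_cast; rw [show (n : ℝ) + 2 - 1 = n + 1 by ring]; ring
    · norm_num [Finset.sum_range_succ]
  · refine hasSum_of_eq tele_nat.neg (fun n => ?_) rfl
    push_cast
    rw [show -((n : ℝ) + 1) - 1 = -(n + 2) by ring, inv_neg, inv_neg]; ring

theorem tele_n (n : ℕ) : HasSum (fun m : ℤ => (m : ℝ)⁻¹ + ((n : ℝ) - m)⁻¹) 0 := by
  induction n with
  | zero => simp [inv_neg, hasSum_zero]
  | succ n ih =>
    have h1 := (Equiv.hasSum_iff (Equiv.subRight (1 : ℤ))).2 ih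
    have := tele_int.add h1
    rw [add_zero] at this
    convert this using 1
    ext m
    simp only [Function.comp, Equiv.subRight_apply]
    push_cast
    rw [show (n : ℝ) - (m - 1) = n + 1 - m by ring]
    ring

theorem inner_sum_eq (α β : ℕ) (hα : 1 ≤ α) (hβ : 1 ≤ β) (n : ℕ) (hn : 0 < n) :
    HasSum (fun m : ℤ => ((m : ℝ)⁻¹) ^ (α+1) * (((n : ℝ) - m)⁻¹) ^ (β+1))
      (∑ i ∈ Finset.range (α+β+1), ((n : ℝ)⁻¹) ^ (α+β+1-i) *
        (((Nat.choose (α+β-i) β + Nat.choose (α+β-i) α : ℕ) : ℝ) * EE (i+1))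
        - (Nat.choose (α+β+2) (α+1) : ℝ) * ((n : ℝ)⁻¹) ^ (α+β+2)) := by
  have hn' : (n : ℝ) ≠ 0 := by positivity
  have key : ∀ i ∈ Finset.range (α+β+1), HasSum (fun m : ℤ => ((n : ℝ)⁻¹) ^ (α+β+1-i) *
      ((Nat.choose (α+β-i) β : ℝ) * ((m : ℝ)⁻¹) ^ (i+1)
        + (Nat.choose (α+β-i) α : ℝ) * (((n : ℝ) - m)⁻¹) ^ (i+1)))
      (((n : ℝ)⁻¹) ^ (α+β+1-i) *
        (((Nat.choose (α+β-i) β + Nat.choose (α+β-i) α : ℕ) : ℝ) * EE (i+1))) := by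
    intro i _
    apply HasSum.mul_left
    rcases i with _ | i
    · have : (α+β).choose α = (α+β).choose β := Nat.choose_symm_add
      have h := (tele_n n).mul_left ((α+β).choose β : ℝ)
      have e : EE (0+1) = 0 := by simp [EE]
      rw [e]
      convert h using 1
      · ext m; simp [this]; ring
      · simp
    · have h1 := hasSum_int (i+1+1) (by omega)
      have h2 := (Equiv.hasSum_iff (Equiv.subLeft (n : ℤ))).2 h1
      have := (h1.mul_left ((Nat.choose (α+β-(i+1)) β : ℝ))).add
        (h2.mul_left ((Nat.choose (α+β-(i+1)) α : ℝ)))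
      convert this using 1
      · ext m; simp
      · push_cast; ring
  have h1 := hasSum_sum key
  have h2 := hasSum_ite_eq (0 : ℤ) ((Nat.choose (α+β+1) (α+1) : ℝ) * ((n : ℝ)⁻¹) ^ (α+β+2))
  have h3 := hasSum_ite_eq (n : ℤ) ((Nat.choose (α+β+1) (β+1) : ℝ) * ((n : ℝ)⁻¹) ^ (α+β+2))
  have h4 := h1.sub (h2.add h3)
  have hh : ∀ γ : ℕ, ∑ i ∈ Finset.range (α+β+1), ((n : ℝ)⁻¹) ^ (α+β+1-i) *
      ((Nat.choose (α+β-i) γ : ℝ) * ((n : ℝ)⁻¹) ^ (i+1))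
      = (Nat.choose (α+β+1) (γ+1) : ℝ) * ((n : ℝ)⁻¹) ^ (α+β+2) := by
    intro γ
    rw [← hockey]
    push_cast
    rw [Finset.sum_mul]
    apply Finset.sum_congr rfl
    intro i hi
    rw [Finset.mem_range] at hi
    have : α + β + 2 = (α+β+1-i) + (i+1) := by omega
    rw [this, pow_add]; ring
  refine hasSum_of_eq h4 (fun m => ?_) ?_
  · by_cases hm : m = 0
    · subst hm
      have : ¬ ((0 : ℤ) = n) := by omega
      simp only [if_true, this, if_false, add_zero, Int.cast_zero, sub_zero, inv_zero]
      rw [← hh α]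
      simp
    · by_cases hm2 : m = n
      · subst hm2
        simp only [if_true, hm, if_false, zero_add, Int.cast_natCast, sub_self, inv_zero]
        rw [← hh β]
        simp
      · simp only [hm, hm2, if_false, add_zero, sub_zero]
        apply pf_s7 _ _ _ _ _ _ _ rfl
        have a1 : (m : ℝ) ≠ 0 := by exact_mod_cast hm
        have a2 : (n : ℝ) - m ≠ 0 := by
          rw [sub_ne_zero]; exact_mod_cast Ne.symm hm2
        field_simp
        ring
  · congr 1
    rw [← add_mul]
    congr 1
    have : (α+β+1).choose (β+1) = (α+β+1).choose α := by
      rw [← Nat.choose_symm_of_eq_add]; omega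
    rw [this, Nat.choose_succ_succ (α+β+1) α]
    push_cast; ring

theorem G_summable (a b : ℕ) (ha : 2 ≤ a) (hb : 2 ≤ b) :
    Summable (fun p : ℤ × ℤ => ((p.1 : ℝ)⁻¹) ^ a * ((p.2 : ℝ)⁻¹) ^ b) := by
  have h1 := (summable_int a ha).norm
  have h2 := (summable_int b hb).norm
  exact summable_mul_of_summable_norm h1 h2

theorem zeta_hasSum (k : ℕ) (hk : 2 ≤ k) :
    HasSum (fun n : ℕ+ => (((n : ℕ) : ℝ)⁻¹) ^ k) (zetaValue k) := by
  have : Summable (fun n : ℕ+ => (((n : ℕ) : ℝ)⁻¹) ^ k) := by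
    have h := (Real.summable_one_div_nat_pow (p := k)).2 (by omega)
    have := h.comp_injective PNat.coe_injective
    simpa [Function.comp_def] using this
  rw [this.hasSum_iff]
  simp [zetaValue]

theorem lhs_eq (a b : ℕ) (ha : 2 ≤ a) (hae : Even a) (hb : 2 ≤ b) (hbo : Odd b) :
    ∑' n : ℕ+, ∑' m : ℤ, ((m : ℝ)⁻¹) ^ a * ((((n : ℕ) : ℝ) - m)⁻¹) ^ b
      = 2 * doubleZeta a b + zetaValue (a + b) := by
  classical
  set G : ℤ × ℤ → ℝ := fun p => ((p.1 : ℝ)⁻¹) ^ a * ((p.2 : ℝ)⁻¹) ^ b with hG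
  have hGs : Summable G := G_summable a b ha hb
  set H : ℤ × ℤ → ℝ := fun p => if 0 < p.1 + p.2 then G p else 0 with hH
  have hHs : Summable H := by
    have := hGs.indicator {p : ℤ × ℤ | 0 < p.1 + p.2}
    refine this.congr fun p => ?_
    simp [Set.indicator_apply, hH]
  let e : ℕ+ × ℤ → ℤ × ℤ := fun x => (x.2, ((x.1 : ℕ) : ℤ) - x.2)
  have he : Function.Injective e := by
    rintro ⟨n, m⟩ ⟨n', m'⟩ h
    simp only [e, Prod.mk.injEq] at h
    obtain ⟨rfl, h⟩ := h
    have : (n : ℕ) = n' := by omega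
    simp [PNat.coe_injective this]
  have hHe : ∀ x, H (e x) = ((x.2 : ℝ)⁻¹) ^ a * ((((x.1 : ℕ) : ℝ) - x.2)⁻¹) ^ b := by
    rintro ⟨n, m⟩
    have := n.pos
    simp [hH, e, hG]
  have s1 : Summable (fun x : ℕ+ × ℤ => H (e x)) := hHs.comp_injective he
  have t1 : ∑' x, H (e x) = ∑' p, H p := by
    apply he.tsum_eq
    intro p hp
    have : 0 < p.1 + p.2 := by
      by_contra h
      exact hp (by simp [hH, h])
    refine ⟨(⟨(p.1 + p.2).toNat, by omega⟩, p.1), ?_⟩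
    ext
    · rfl
    · simp [e]; omega
  have t2 := s1.tsum_prod
  simp only [hHe] at t2 t1
  rw [← t2, t1]
  -- now reduce to positive pairs
  have hH1 : ∀ q, H (0, q) = 0 := by intro q; simp [hH, hG]; omega
  have hH2 : ∀ p, H (p, 0) = 0 := by intro q; simp [hH, hG]; omega
  rw [hHs.tsum_prod, intsum (fun p => ∑' q, H (p, q)) hHs.prod (by simp [hH1])]
  have hq : ∀ p : ℤ, ∑' q, H (p, q) = ∑' q : ℕ+, (H (p, ((q : ℕ) : ℤ)) + H (p, -((q : ℕ) : ℤ))) :=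
    fun p => intsum _ (hHs.prod_factor p) (hH2 p)
  have hqs : ∀ p : ℤ, Summable fun q : ℕ+ => (H (p, ((q : ℕ) : ℤ)) + H (p, -((q : ℕ) : ℤ))) := by
    intro p
    apply Summable.add
    · exact (hHs.prod_factor p).comp_injective (i := fun q : ℕ+ => ((q : ℕ) : ℤ))
        (fun x y h => PNat.coe_injective (by simpa using h))
    · exact (hHs.prod_factor p).comp_injective (i := fun q : ℕ+ => -((q : ℕ) : ℤ))
        (fun x y h => PNat.coe_injective (by simpa using h))
  simp only [hq]
  let K : ℕ+ × ℕ+ → ℝ := fun p => 1 / (((p.1 : ℕ) : ℝ) ^ a * ((p.2 : ℕ) : ℝ) ^ b)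
  have hK : Summable K := by
    have := hGs.comp_injective (i := fun p : ℕ+ × ℕ+ => (((p.1 : ℕ) : ℤ), ((p.2 : ℕ) : ℤ)))
      (by rintro ⟨x, y⟩ ⟨z, w⟩ h; simpa using h)
    refine this.congr ?_
    intro p
    simp [hG, K, mul_comm]
  have hKl : Summable (fun p : ℕ+ × ℕ+ => if p.1 < p.2 then K p else 0) :=
    (hK.indicator {p : ℕ+ × ℕ+ | p.1 < p.2}).congr fun p => by simp [Set.indicator_apply]
  have hKd : Summable (fun p : ℕ+ × ℕ+ => if p.1 = p.2 then K p else 0) :=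
    (hK.indicator {p : ℕ+ × ℕ+ | p.1 = p.2}).congr fun p => by simp [Set.indicator_apply]
  have four : ∀ p q : ℕ+, (H (((p : ℕ) : ℤ), ((q : ℕ) : ℤ)) + H (((p : ℕ) : ℤ), -((q : ℕ) : ℤ)))
      + (H (-((p : ℕ) : ℤ), ((q : ℕ) : ℤ)) + H (-((p : ℕ) : ℤ), -((q : ℕ) : ℤ)))
      = 2 * (if p < q then K (p, q) else 0) + (if p = q then K (p, q) else 0) := by
    intro p q
    have hp := p.pos
    have hq := q.pos
    have l1 : (p < q) ↔ (p : ℕ) < q := Iff.rfl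
    have l2 : (p = q) ↔ (p : ℕ) = q := PNat.coe_inj.symm
    have g1 : G (((p : ℕ) : ℤ), ((q : ℕ) : ℤ)) = K (p, q) := by simp [hG, K, mul_comm]
    have g2 : G (((p : ℕ) : ℤ), -((q : ℕ) : ℤ)) = - K (p, q) := by
      simp [hG, K, mul_comm, inv_neg, hbo.neg_pow]
    have g3 : G (-((p : ℕ) : ℤ), ((q : ℕ) : ℤ)) = K (p, q) := by
      simp [hG, K, mul_comm, inv_neg, hae.neg_pow]
    simp only [hH, g1, g2, g3, l1, l2]
    rw [if_pos (by omega), if_neg (show ¬ (0 < -((p : ℕ) : ℤ) + -((q : ℕ) : ℤ)) by omega)]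
    rcases lt_trichotomy (p : ℕ) q with h | h | h
    · rw [if_neg (by omega), if_pos (by omega), if_pos h, if_neg (by omega)]; ring
    · rw [if_neg (by omega), if_neg (by omega), if_neg (by omega), if_pos h]; ring
    · rw [if_pos (by omega), if_neg (by omega), if_neg (by omega), if_neg (by omega)]; ring
  have step : ∀ p : ℕ+, (∑' q : ℕ+, (H (((p : ℕ) : ℤ), ((q : ℕ) : ℤ)) + H (((p : ℕ) : ℤ), -((q : ℕ) : ℤ))))
      + (∑' q : ℕ+, (H (-((p : ℕ) : ℤ), ((q : ℕ) : ℤ)) + H (-((p : ℕ) : ℤ), -((q : ℕ) : ℤ))))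
      = ∑' q : ℕ+, (2 * (if p < q then K (p, q) else 0) + (if p = q then K (p, q) else 0)) := by
    intro p
    rw [← (hqs _).tsum_add (hqs _)]
    exact tsum_congr (four p)
  rw [tsum_congr step]
  have sT := (hKl.mul_left 2).add hKd
  have := sT.tsum_prod
  simp only at this
  rw [← this, (hKl.mul_left 2).tsum_add hKd, tsum_mul_left]
  congr 1
  · congr 1
    unfold doubleZeta
    have := tsum_subtype {p : ℕ+ × ℕ+ | p.1 < p.2} K
    refine Eq.trans ?_ this.symm
    apply tsum_congr
    intro p
    simp [Set.indicator_apply]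
  · rw [hKd.tsum_prod]
    unfold zetaValue
    apply tsum_congr
    intro p
    simp [K, pow_add, mul_comm]

/-- for `a ≥ 2` even and `b ≥ 3` odd, `N = a + b`,
`ζ(a,b) = ∑_{r odd, 3 ≤ r ≤ N-2} (C(r-1,b-1) + C(r-1,a-1)) ζ(r) ζ(N-r) - ½(C(N,a)+1) ζ(N)`. -/
theorem doubleZeta_even_odd (a b : ℕ) (ha : 2 ≤ a) (hae : Even a)
    (hb : 3 ≤ b) (hbo : Odd b) :
    doubleZeta a b =
      (∑ r ∈ (Finset.Icc 3 (a + b - 2)).filter (fun r => Odd r),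
        ((Nat.choose (r - 1) (b - 1) + Nat.choose (r - 1) (a - 1) : ℕ) : ℝ) *
          zetaValue r * zetaValue (a + b - r)) -
      (1 / 2) * (((Nat.choose (a + b) a : ℕ) : ℝ) + 1) * zetaValue (a + b) := by
  have hl := lhs_eq a b ha hae (by omega) hbo
  obtain ⟨α, rfl⟩ : ∃ α, a = α + 1 := ⟨a - 1, by omega⟩
  obtain ⟨β, rfl⟩ : ∃ β, b = β + 1 := ⟨b - 1, by omega⟩
  have hi : ∀ n : ℕ+, _ := fun n : ℕ+ =>
    (inner_sum_eq α β (by omega) (by omega) n n.pos).tsum_eq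
  rw [tsum_congr hi] at hl
  have hterm : ∀ i ∈ Finset.range (α+β+1), HasSum (fun n : ℕ+ => (((n : ℕ) : ℝ)⁻¹) ^ (α+β+1-i) *
        (((Nat.choose (α+β-i) β + Nat.choose (α+β-i) α : ℕ) : ℝ) * EE (i+1)))
        (zetaValue (α+β+1-i) *
        (((Nat.choose (α+β-i) β + Nat.choose (α+β-i) α : ℕ) : ℝ) * EE (i+1))) := by
    intro i hi
    rw [Finset.mem_range] at hi
    by_cases h : i = α + β
    · subst h
      rw [Nat.sub_self, Nat.choose_eq_zero_of_lt (show 0 < β by omega),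
        Nat.choose_eq_zero_of_lt (show 0 < α by omega)]
      simp [hasSum_zero]
    · exact (zeta_hasSum _ (by omega)).mul_right _
  have hs := (hasSum_sum hterm).sub ((zeta_hasSum (α+β+2) (by omega)).mul_left
    (Nat.choose (α+β+2) (α+1) : ℝ))
  rw [hs.tsum_eq] at hl
  have hre : ∑ i ∈ Finset.range (α+β+1), (zetaValue (α+β+1-i) *
        (((Nat.choose (α+β-i) β + Nat.choose (α+β-i) α : ℕ) : ℝ) * EE (i+1)))
      = 2 * ∑ r ∈ (Finset.Icc 3 (α + 1 + (β + 1) - 2)).filter (fun r => Odd r),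
        ((Nat.choose (r - 1) (β + 1 - 1) + Nat.choose (r - 1) (α + 1 - 1) : ℕ) : ℝ) *
          zetaValue r * zetaValue (α + 1 + (β + 1) - r) := by
    have hodd : Odd (α + β) := by
      rcases hae with ⟨x, hx⟩
      rcases hbo with ⟨y, hy⟩
      exact ⟨x + y - 1, by omega⟩
    rw [Finset.mul_sum]
    symm
    apply Finset.sum_of_injOn (fun r => α + β + 1 - r)
    · intro r hr s hs h
      simp only [Finset.coe_filter, Finset.mem_Icc, Set.mem_ofPred_eq] at hr hs h
      omega
    · intro r hr
      simp only [Finset.coe_filter, Finset.mem_Icc, Set.mem_ofPred_eq] at hr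
      simp only [Finset.coe_range, Set.mem_Iio]
      omega
    · intro i hi hni
      rw [Finset.mem_range] at hi
      have : ¬ Even (i + 1) ∨ i = α + β := by
        by_contra! hc
        obtain ⟨h1, h2⟩ := hc
        apply hni
        refine ⟨α + β + 1 - i, ?_, ?_⟩
        · simp only [Finset.coe_filter, Finset.mem_Icc, Set.mem_ofPred_eq]
          rw [Nat.even_iff] at h1
          rw [Nat.odd_iff] at *
          omega
        · simp only; omega
      rcases this with h | h
      · simp [EE, h]
      · subst h
        rw [Nat.sub_self, Nat.choose_eq_zero_of_lt (show 0 < β by omega),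
          Nat.choose_eq_zero_of_lt (show 0 < α by omega)]
        simp
    · intro r hr
      simp only [Finset.mem_filter, Finset.mem_Icc] at hr
      have e1 : α + β + 1 - (α + β + 1 - r) = r := by omega
      have e2 : α + β - (α + β + 1 - r) = r - 1 := by omega
      have e3 : α + β + 1 - r + 1 = α + 1 + (β + 1) - r := by omega
      have e4 : Even (α + 1 + (β + 1) - r) := by
        rw [Nat.even_iff]
        rw [Nat.odd_iff] at *
        omega
      simp only [e1, e2, e3, EE, e4, if_true, Nat.add_sub_cancel]
      ring
  rw [hre] at hl
  have e5 : α + 1 + (β + 1) = α + β + 2 := by ring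
  rw [e5] at hl ⊢
  linarith
end

section
/- Let a and b be distinct positive integers of the same parity with b ≥ 2, and set N = a + b. Then the set (I(a,b) ∩ J(a,b)) \ {0, N} is empty if and only if N is divisible by 4 and a = N/2 − 1. -/
/-- The finite set `I(a,b)` attached to a double zeta value `ζ(a,b)` (with `N = a + b`):
`{0, a, 2a}` if `a = b`; the odd integers in `[b, N-2]` together with `{0, N}` if `b < a`;
the odd integers in `[a+1, N-2]` together with `{0, N}` if `b > a`. -/
def Iset (a b : ℕ) : Finset ℕ :=
  if a = b then {0, a, 2 * a}
  else if b < a then ((Finset.Icc b (a + b - 2)).filter (fun r => Odd r)) ∪ {0, a + b}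
  else ((Finset.Icc (a + 1) (a + b - 2)).filter (fun r => Odd r)) ∪ {0, a + b}

/-- The set `J(a,b) = {N - i : i ∈ I(a,b)}` where `N = a + b`. -/
def Jset (a b : ℕ) : Finset ℕ := (Iset a b).image (fun i => a + b - i)

theorem mem_diff_aux (a b x : ℕ) (ha : 1 ≤ a) (hb : 2 ≤ b)
    (hne : a ≠ b) (hpar : a % 2 = b % 2) :
    x ∈ (Iset a b ∩ Jset a b) \ {0, a + b} ↔
      x % 2 = 1 ∧ ((b < a ∧ b ≤ x ∧ x ≤ a) ∨ (a < b ∧ a + 1 ≤ x ∧ x + 1 ≤ b)) := by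
  unfold Jset Iset
  rw [if_neg hne]
  split_ifs with h
  all_goals
    simp only [Finset.mem_sdiff, Finset.mem_inter, Finset.mem_image, Finset.mem_union,
      Finset.mem_filter, Finset.mem_Icc, Finset.mem_insert, Finset.mem_singleton, Nat.odd_iff]
    constructor
    · rintro ⟨⟨h1, y, h2, h3⟩, h4⟩
      omega
    · intro h1
      refine ⟨⟨by omega, a + b - x, by omega, by omega⟩, by omega⟩

/-- for distinct `a`, `b` of the same parity with `b ≥ 2`,
`(I(a,b) ∩ J(a,b)) \ {0, N}` is empty iff `4 ∣ N` and `a = N/2 − 1`. -/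
theorem inter_Iset_Jset_empty_iff (a b : ℕ) (ha : 1 ≤ a) (hb : 2 ≤ b)
    (hne : a ≠ b) (hpar : a % 2 = b % 2) :
    (Iset a b ∩ Jset a b) \ {0, a + b} = ∅ ↔
      4 ∣ (a + b) ∧ a = (a + b) / 2 - 1 := by
  rw [Finset.eq_empty_iff_forall_notMem]
  simp only [mem_diff_aux a b _ ha hb hne hpar]
  constructor
  · intro h
    rcases lt_or_gt_of_ne hne with hab | hab
    · rcases Nat.mod_two_eq_zero_or_one a with hm | hm
      · exact absurd ⟨by omega, Or.inr ⟨hab, by omega, by omega⟩⟩ (h (a + 1))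
      · by_cases hb2 : b = a + 2
        · omega
        · exact absurd ⟨by omega, Or.inr ⟨hab, by omega, by omega⟩⟩ (h (a + 2))
    · rcases Nat.mod_two_eq_zero_or_one b with hm | hm
      · exact absurd ⟨by omega, Or.inl ⟨hab, by omega, by omega⟩⟩ (h (b + 1))
      · exact absurd ⟨by omega, Or.inl ⟨hab, by omega, by omega⟩⟩ (h b)
  · rintro h x hx
    omega
end
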